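/- For every pair of bits q₁, q₅ ∈ {0,1}, every middle string A = (0, A₁, A₀) with A₁, A₀ ∈ {0,1}, every sign s ∈ {+1,−1}, and all bits i,j,k ∈ {0,1} with i+j+k odd, the 5-qubit vector v_{A,y,s} satisfies (Y ⊗ P_i ⊗ P_j ⊗ P_k ⊗ I) v_{A,y,s} = s · (√−1)^{i+j+k+1} · (−1)^{q₁ + j A₁ + k A₀} · v_{A,y,s}. (This single formula reproduces the paper's four listed cases: eigenvalue ±(−1)^{q₁}α for A=000, ±(−1)^{q₁+k}α for A=001, ±(−1)^{q₁+j}α for A=010, and ∓(−1)^{q₁+i}α for A=011, where α=(√−1)^{i+j+k+1}, using that i+j+k is odd.) -/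

import Mathlib

open Matrix Complex

noncomputable section

/-- Single-qubit Pauli X. -/
def Xg : Matrix (Fin 2) (Fin 2) ℂ := !![0, 1; 1, 0]
/-- Single-qubit Pauli Y. -/
def Yg : Matrix (Fin 2) (Fin 2) ℂ := !![0, -Complex.I; Complex.I, 0]
/-- Single-qubit Pauli Z. -/
def Zg : Matrix (Fin 2) (Fin 2) ℂ := !![1, 0; 0, -1]
/-- P₀ = X, P₁ = Y. -/
def Pg : Fin 2 → Matrix (Fin 2) (Fin 2) ℂ := fun i => if i = 0 then Xg else Yg

/-- Tensor (Kronecker) product of `n` single-qubit operators, as a matrix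
indexed by bit strings. -/
def tens {n : ℕ} (M : Fin n → Matrix (Fin 2) (Fin 2) ℂ) :
    Matrix (Fin n → Fin 2) (Fin n → Fin 2) ℂ :=
  Matrix.of fun r c => ∏ m, M m (r m) (c m)

/-- Computational basis vector |q⟩. -/
def ket {n : ℕ} (q : Fin n → Fin 2) : (Fin n → Fin 2) → ℂ :=
  fun r => if r = q then 1 else 0

/-- The eigenvector v_{A,y,s} of the paper (5 qubits), with A = (0, A₁, A₀). -/
def vAy (q₁ q₅ A₁ A₀ : Fin 2) (s : ℂ) : (Fin 5 → Fin 2) → ℂ :=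
  (- ket ![q₁, 0, A₁, A₀, q₅] + ket ![q₁+1, 0, A₁, A₀, q₅]
    + ket ![q₁, 0, A₁, A₀, q₅+1] + ket ![q₁+1, 0, A₁, A₀, q₅+1])
  + s • (ket ![q₁+1, 1, A₁+1, A₀+1, q₅+1] - ket ![q₁, 1, A₁+1, A₀+1, q₅]
    - ket ![q₁+1, 1, A₁+1, A₀+1, q₅] - ket ![q₁, 1, A₁+1, A₀+1, q₅+1])

/-- A tensor product of operators that each map a basis state to a multiple of a basis state
does the same on the product state. -/
theorem tens_mulVec_ket {n : ℕ} {M : Fin n → Matrix (Fin 2) (Fin 2) ℂ} {q q' : Fin n → Fin 2}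
    {c : Fin n → ℂ} (h : ∀ m r, M m r (q m) = if r = q' m then c m else 0) :
    (tens M).mulVec (ket q) = (∏ m, c m) • ket q' := by
  ext r
  have hr : (∏ m, M m (r m) (q m)) = if r = q' then ∏ m, c m else 0 := by
    simp only [h, Finset.prod_ite_zero, Finset.mem_univ, true_imp_iff, funext_iff]
  simp [mulVec, dotProduct, tens, ket, hr]

theorem Pg_apply (i r q : Fin 2) :
    Pg i r q = if r = q + 1 then I ^ (i : ℕ) * (-1) ^ ((i : ℕ) * (q : ℕ)) else 0 := by
  fin_cases i <;> fin_cases r <;> fin_cases q <;> simp [Pg, Xg, Yg]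

theorem neg_one_pow_mul_val_add_one (n : ℕ) (q : Fin 2) :
    (-1 : ℂ) ^ (n * ((q + 1 : Fin 2) : ℕ)) = (-1) ^ n * (-1) ^ (n * (q : ℕ)) := by
  fin_cases q <;> simp [← mul_pow]

theorem tens_Yg_Pg_mulVec_ket (i j k a b c d e : Fin 2) :
    (tens ![Yg, Pg i, Pg j, Pg k, 1]).mulVec (ket ![a, b, c, d, e]) =
      (I ^ ((i : ℕ) + j + k + 1) * ((-1) ^ (1 * (a : ℕ)) * (-1) ^ ((i : ℕ) * (b : ℕ)) *
        (-1) ^ ((j : ℕ) * (c : ℕ)) * (-1) ^ ((k : ℕ) * (d : ℕ)))) •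
        ket ![a + 1, b + 1, c + 1, d + 1, e] := by
  let phase (i q : Fin 2) : ℂ := I ^ (i : ℕ) * (-1) ^ ((i : ℕ) * (q : ℕ))
  rw [tens_mulVec_ket (q' := ![a + 1, b + 1, c + 1, d + 1, e])
    (c := ![phase 1 a, phase i b, phase j c, phase k d, 1])]
  · congr 1
    simp [Fin.prod_univ_five, phase]
    ring
  · intro m r
    match m with
    | 0 => exact Pg_apply 1 r a
    | 1 => exact Pg_apply i r b
    | 2 => exact Pg_apply j r c
    | 3 => exact Pg_apply k r d
    | 4 => exact Matrix.one_apply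

theorem stmt13 (q₁ q₅ A₁ A₀ : Fin 2) (s : ℂ) (hs : s = 1 ∨ s = -1)
    (i j k : Fin 2) (hodd : Odd ((i : ℕ) + (j : ℕ) + (k : ℕ))) :
    (tens ![Yg, Pg i, Pg j, Pg k, 1]).mulVec (vAy q₁ q₅ A₁ A₀ s) =
      (s * Complex.I ^ ((i : ℕ) + (j : ℕ) + (k : ℕ) + 1) *
        (-1 : ℂ) ^ ((q₁ : ℕ) + (j : ℕ) * (A₁ : ℕ) + (k : ℕ) * (A₀ : ℕ))) •
        vAy q₁ q₅ A₁ A₀ s := by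
  have hs2 : s * s = 1 := by rcases hs with rfl | rfl <;> norm_num
  have hq (q : Fin 2) : q + 1 + 1 = q := by fin_cases q <;> rfl
  have hijk : (-1 : ℂ) ^ (i : ℕ) * (-1) ^ (j : ℕ) * (-1) ^ (k : ℕ) = -1 := by
    rw [← pow_add, ← pow_add, hodd.neg_one_pow]
  have hq₁ : (-1 : ℂ) ^ ((q₁ + 1 : Fin 2) : ℕ) = -(-1) ^ (q₁ : ℕ) := by
    simpa using neg_one_pow_mul_val_add_one 1 q₁
  have h01 : (0 : Fin 2) + 1 = 1 := rfl
  have h10 : (1 : Fin 2) + 1 = 0 := rfl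
  simp only [vAy, mulVec_add, mulVec_sub, mulVec_neg, mulVec_smul, tens_Yg_Pg_mulVec_ket, hq, hq₁,
    h01, h10, neg_one_pow_mul_val_add_one, Fin.val_zero, Fin.val_one, mul_zero, pow_zero, mul_one,
    one_mul, pow_add _ (_ + _) (_ * _), pow_add _ _ (_ * _)]
  generalize I ^ ((i : ℕ) + j + k + 1) = u
  generalize (-1 : ℂ) ^ (q₁ : ℕ) = x
  generalize (-1 : ℂ) ^ ((j : ℕ) * (A₁ : ℕ)) = y
  generalize (-1 : ℂ) ^ ((k : ℕ) * (A₀ : ℕ)) = z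
  generalize (-1 : ℂ) ^ (i : ℕ) = f at *
  generalize (-1 : ℂ) ^ (j : ℕ) = g at *
  generalize (-1 : ℂ) ^ (k : ℕ) = h at *
  match_scalars
  all_goals first
    | linear_combination (u * x * y * z) * hs2
    | linear_combination -(u * x * y * z) * hs2
    | linear_combination (s * u * x * y * z) * hijk
    | linear_combination -(s * u * x * y * z) * hijk
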